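/- On the board Rhombus(6), for every hole v, the v-complement problem has a solution consisting of at most 14 moves, and has no solution consisting of fewer than 13 moves. -/

import Mathlib

/-- The six jump directions on the triangular lattice (oblique coordinates). -/
def Dirs : Finset (ℤ × ℤ) := {(1,0), (-1,0), (0,1), (0,-1), (1,1), (-1,-1)}

/-- The rhombus board of side `n`: `{0,…,n−1} × {0,…,n−1}`. -/
noncomputable def Rhombus (n : ℕ) : Finset (ℤ × ℤ) :=
  Finset.Icc (0 : ℤ) ((n : ℤ) - 1) ×ˢ Finset.Icc (0 : ℤ) ((n : ℤ) - 1)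

/-- A jump in position `P` on board `B`: peg at `p`, direction `d ∈ Dirs`,
peg at `p+d`, empty board hole at `p+2d`. -/
def JumpOK (B P : Finset (ℤ × ℤ)) (p d : ℤ × ℤ) : Prop :=
  d ∈ Dirs ∧ p ∈ P ∧ p + d ∈ P ∧ p + d + d ∈ B ∧ p + d + d ∉ P

/-- The position resulting from the jump `(p, d)` in position `P`. -/
def jumpResult (P : Finset (ℤ × ℤ)) (p d : ℤ × ℤ) : Finset (ℤ × ℤ) :=
  (P \ {p, p + d}) ∪ {p + d + d}

/-- `SweepFrom B P s ds e Q`: starting in position `P`, the peg at `s` makes the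
consecutive jumps with directions `ds` (each jump starting where the previous landed),
ending at hole `e` and producing position `Q`.  A move is such a sweep with `ds ≠ []`;
its length (number of pegs captured) is `ds.length`. -/
inductive SweepFrom (B : Finset (ℤ × ℤ)) :
    Finset (ℤ × ℤ) → ℤ × ℤ → List (ℤ × ℤ) → ℤ × ℤ → Finset (ℤ × ℤ) → Prop
  | nil (P : Finset (ℤ × ℤ)) (s : ℤ × ℤ) : SweepFrom B P s [] s P
  | cons {P : Finset (ℤ × ℤ)} {s d e : ℤ × ℤ} {ds : List (ℤ × ℤ)} {Q : Finset (ℤ × ℤ)} :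
      JumpOK B P s d → SweepFrom B (jumpResult P s d) (s + d + d) ds e Q →
      SweepFrom B P s (d :: ds) e Q

/-- A move is recorded as a pair (starting hole, nonempty list of jump directions).
`PlayMove B P m Q` says the move `m` is legal in position `P` and produces `Q`. -/
def PlayMove (B P : Finset (ℤ × ℤ)) (m : (ℤ × ℤ) × List (ℤ × ℤ))
    (Q : Finset (ℤ × ℤ)) : Prop :=
  m.2 ≠ [] ∧ ∃ e, SweepFrom B P m.1 m.2 e Q

/-- `Plays B P ms Q`: the finite sequence of moves `ms` leads from position `P`
to position `Q` on board `B`. -/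
inductive Plays (B : Finset (ℤ × ℤ)) :
    Finset (ℤ × ℤ) → List ((ℤ × ℤ) × List (ℤ × ℤ)) → Finset (ℤ × ℤ) → Prop
  | nil (P : Finset (ℤ × ℤ)) : Plays B P [] P
  | cons {P Q R : Finset (ℤ × ℤ)} {m : (ℤ × ℤ) × List (ℤ × ℤ)}
      {ms : List ((ℤ × ℤ) × List (ℤ × ℤ))} :
      PlayMove B P m Q → Plays B Q ms R → Plays B P (m :: ms) R

/-- The list of all holes touched by a sweep starting at `s` with directions `ds`:
every starting hole, every jumped-over hole and every landing hole. -/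
def sweepHoles (s : ℤ × ℤ) : List (ℤ × ℤ) → List (ℤ × ℤ)
  | [] => [s]
  | d :: ds => s :: (s + d) :: sweepHoles (s + d + d) ds

/-- The hole where a sweep starting at `s` with directions `ds` ends. -/
def sweepEnd (s : ℤ × ℤ) : List (ℤ × ℤ) → ℤ × ℤ
  | [] => s
  | d :: ds => sweepEnd (s + d + d) ds

/-- A single jump as a step relation between positions on board `B`. -/
def JumpStep (B P Q : Finset (ℤ × ℤ)) : Prop :=
  ∃ p d, JumpOK B P p d ∧ Q = jumpResult P p d

/-! ### Symmetries of the board -/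

theorem SweepFrom.image {B P Q : Finset (ℤ × ℤ)} {s e : ℤ × ℤ} {ds : List (ℤ × ℤ)}
    {σ τ : ℤ × ℤ → ℤ × ℤ} (hσ : σ.Injective) (hadd : ∀ p d, σ (p + d) = σ p + τ d)
    (hτ : ∀ d ∈ Dirs, τ d ∈ Dirs) (hB : ∀ p ∈ B, σ p ∈ B) (h : SweepFrom B P s ds e Q) :
    SweepFrom B (P.image σ) (σ s) (ds.map τ) (σ e) (Q.image σ) := by
  induction h with
  | nil P s => exact .nil _ _
  | @cons P s d e ds Q hj _ ih =>
    obtain ⟨hd, h₁, h₂, h₃, h₄⟩ := hj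
    have hres : (jumpResult P s d).image σ = jumpResult (P.image σ) (σ s) (τ d) := by
      simp only [jumpResult, Finset.image_union, Finset.image_sdiff _ _ hσ, Finset.image_insert,
        Finset.image_singleton, hadd]
    refine .cons ⟨hτ d hd, Finset.mem_image_of_mem σ h₁, ?_, ?_, ?_⟩ ?_
    · exact hadd s d ▸ Finset.mem_image_of_mem σ h₂
    · rw [← hadd, ← hadd]
      exact hB _ h₃
    · rw [← hadd, ← hadd, hσ.mem_finset_image]
      exact h₄
    · rw [← hres, ← hadd, ← hadd]
      exact ih

theorem Plays.image {B P Q : Finset (ℤ × ℤ)} {ms : List ((ℤ × ℤ) × List (ℤ × ℤ))}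
    {σ τ : ℤ × ℤ → ℤ × ℤ} (hσ : σ.Injective) (hadd : ∀ p d, σ (p + d) = σ p + τ d)
    (hτ : ∀ d ∈ Dirs, τ d ∈ Dirs) (hB : ∀ p ∈ B, σ p ∈ B) (h : Plays B P ms Q) :
    Plays B (P.image σ) (ms.map fun m => (σ m.1, m.2.map τ)) (Q.image σ) := by
  induction h with
  | nil P => exact .nil _
  | cons hm _ ih =>
    obtain ⟨hne, e, hs⟩ := hm
    exact .cons ⟨by simpa using hne, σ e, hs.image hσ hadd hτ hB⟩ ih

/-- The `v`-complement problem on `Rhombus 6` has a solution of exactly `k` moves. -/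
def ComplementSolvable (v : ℤ × ℤ) (k : ℕ) : Prop :=
  ∃ ms : List ((ℤ × ℤ) × List (ℤ × ℤ)),
    Plays (Rhombus 6) ((Rhombus 6).erase v) ms {v} ∧ ms.length = k

theorem mem_rhombus_six {p : ℤ × ℤ} :
    p ∈ Rhombus 6 ↔ (0 ≤ p.1 ∧ p.1 ≤ 5) ∧ 0 ≤ p.2 ∧ p.2 ≤ 5 := by
  simp [Rhombus]

theorem ComplementSolvable.image {v : ℤ × ℤ} {k : ℕ} {σ τ : ℤ × ℤ → ℤ × ℤ} (hσ : σ.Injective)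
    (hadd : ∀ p d, σ (p + d) = σ p + τ d) (hτ : ∀ d ∈ Dirs, τ d ∈ Dirs)
    (hB : ∀ p ∈ Rhombus 6, σ p ∈ Rhombus 6) (h : ComplementSolvable v k) :
    ComplementSolvable (σ v) k := by
  obtain ⟨ms, hms, rfl⟩ := h
  have himage : (Rhombus 6).image σ = Rhombus 6 :=
    Finset.eq_of_subset_of_card_le (Finset.image_subset_iff.2 hB)
      (Finset.card_image_of_injective _ hσ).ge
  have := hms.image hσ hadd hτ hB
  rw [Finset.image_erase hσ, Finset.image_singleton, himage] at this
  exact ⟨_, this, List.length_map _⟩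

theorem ComplementSolvable.swap {v : ℤ × ℤ} {k : ℕ} (h : ComplementSolvable v k) :
    ComplementSolvable v.swap k :=
  h.image (τ := Prod.swap) Prod.swap_injective (fun _ _ => rfl) (by decide)
    (fun p hp => by simp only [mem_rhombus_six, Prod.fst_swap, Prod.snd_swap] at hp ⊢; tauto)

theorem ComplementSolvable.rotate {v : ℤ × ℤ} {k : ℕ} (h : ComplementSolvable v k) :
    ComplementSolvable ((5, 5) - v) k :=
  h.image (σ := fun p => (5, 5) - p) (τ := Neg.neg) sub_right_injective
    (fun _ _ => by rw [sub_add_eq_sub_sub, sub_eq_add_neg _ (_ : ℤ × ℤ)]) (by decide)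
    (fun p hp => by
      simp only [mem_rhombus_six, Prod.fst_sub, Prod.snd_sub] at hp ⊢
      omega)

/-! ### Regions that cost a move -/

/-- A nonempty set `R` such that every jump over a hole of `R` starts or lands in `R`. -/
def IsMersonRegion (B R : Finset (ℤ × ℤ)) : Prop :=
  R.Nonempty ∧ ∀ p ∈ B, ∀ d ∈ Dirs, p + d + d ∈ B → p + d ∈ R → p ∈ R ∨ p + d + d ∈ R

theorem jumpResult_subset {B P : Finset (ℤ × ℤ)} {p d : ℤ × ℤ} (hPB : P ⊆ B)
    (hj : JumpOK B P p d) : jumpResult P p d ⊆ B :=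
  Finset.union_subset (Finset.sdiff_subset.trans hPB) (Finset.singleton_subset_iff.2 hj.2.2.2.1)

theorem SweepFrom.subset_board {B P Q : Finset (ℤ × ℤ)} {s e : ℤ × ℤ} {ds : List (ℤ × ℤ)}
    (h : SweepFrom B P s ds e Q) (hPB : P ⊆ B) : Q ⊆ B := by
  induction h with
  | nil => exact hPB
  | cons hj _ ih => exact ih (jumpResult_subset hPB hj)

theorem mem_jumpResult_landing (P : Finset (ℤ × ℤ)) (p d : ℤ × ℤ) :
    p + d + d ∈ jumpResult P p d := by
  simp [jumpResult]

theorem SweepFrom.end_mem {B P Q : Finset (ℤ × ℤ)} {s e : ℤ × ℤ} {ds : List (ℤ × ℤ)}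
    (h : SweepFrom B P s ds e Q) (hs : s ∈ P) : e ∈ Q := by
  induction h with
  | nil => exact hs
  | cons _ _ ih => exact ih (mem_jumpResult_landing _ _ _)

/-- A move that starts outside a full region leaves it full and does not end in it. -/
theorem SweepFrom.region_subset {B P Q R : Finset (ℤ × ℤ)} {s e : ℤ × ℤ} {ds : List (ℤ × ℤ)}
    (h : SweepFrom B P s ds e Q) (hPB : P ⊆ B) (hR : IsMersonRegion B R) (hRP : R ⊆ P)
    (hs : s ∉ R) : R ⊆ Q ∧ e ∉ R := by
  induction h with
  | nil => exact ⟨hRP, hs⟩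
  | @cons P s d e ds Q hj _ ih =>
    have hland : s + d + d ∉ R := fun h => hj.2.2.2.2 (hRP h)
    have hover : s + d ∉ R := fun h =>
      (hR.2 s (hPB hj.2.1) d hj.1 hj.2.2.2.1 h).elim hs hland
    refine ih (jumpResult_subset hPB hj) (fun r hr => ?_) hland
    refine Finset.mem_union_left _ (Finset.mem_sdiff.2 ⟨hRP hr, ?_⟩)
    simp only [Finset.mem_insert, Finset.mem_singleton, not_or]
    exact ⟨fun h => hs (h ▸ hr), fun h => hover (h ▸ hr)⟩

theorem PlayMove.start_mem {B P Q : Finset (ℤ × ℤ)} {m : (ℤ × ℤ) × List (ℤ × ℤ)}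
    (h : PlayMove B P m Q) : m.1 ∈ P := by
  obtain ⟨s, ds⟩ := m
  obtain ⟨hne, e, hs⟩ := h
  cases hs with
  | nil => exact absurd rfl hne
  | cons hj _ => exact hj.2.1

theorem length_le_length_filter_notMem_add_one {α : Type*} [DecidableEq α] (s : α)
    {L : List (Finset α)} (hL : L.Pairwise Disjoint) :
    L.length ≤ (L.filter (s ∉ ·)).length + 1 := by
  induction L with
  | nil => simp
  | cons R L ih =>
    rw [List.pairwise_cons] at hL
    by_cases hs : s ∈ R
    · have : L.filter (s ∉ ·) = L := List.filter_eq_self.2 fun T hT => by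
        simpa using Finset.disjoint_left.1 (hL.1 T hT) hs
      rw [List.filter_cons_of_neg (by simpa using hs), this, List.length_cons]
    · simpa [hs] using ih hL.2

/-- Disjoint full regions give a lower bound for the number of moves. -/
theorem Plays.length_regions_le {B P Q : Finset (ℤ × ℤ)} {v : ℤ × ℤ}
    {ms : List ((ℤ × ℤ) × List (ℤ × ℤ))} (h : Plays B P ms Q) (hQ : Q = {v}) (hPB : P ⊆ B)
    (hms : ms ≠ []) {L : List (Finset (ℤ × ℤ))} (hdisj : L.Pairwise Disjoint)
    (hL : ∀ R ∈ L, IsMersonRegion B R ∧ R ⊆ P) : L.length ≤ ms.length := by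
  induction h generalizing L with
  | nil => exact absurd rfl hms
  | @cons P Q' Q m ms hm hplays ih =>
    have hsM := hm.start_mem
    obtain ⟨hne, e, hs⟩ := hm
    have key : ∀ R ∈ L.filter (m.1 ∉ ·), IsMersonRegion B R ∧ R ⊆ Q' ∧ e ∉ R := fun R hR => by
      simp only [List.mem_filter, decide_eq_true_eq] at hR
      exact ⟨(hL R hR.1).1, hs.region_subset hPB (hL R hR.1).1 (hL R hR.1).2 hR.2⟩
    have hlen := length_le_length_filter_notMem_add_one m.1 hdisj
    rw [List.length_cons]
    by_cases hnil : ms = []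
    · subst hnil
      cases hplays
      have : L.filter (m.1 ∉ ·) = [] := List.eq_nil_iff_forall_not_mem.2 fun R hR => by
        obtain ⟨hR, hRQ, heR⟩ := key R hR
        obtain ⟨r, hr⟩ := hR.1
        have he := hs.end_mem hsM
        have hr' := hRQ hr
        rw [hQ, Finset.mem_singleton] at he hr'
        exact heR (he ▸ hr' ▸ hr)
      rwa [this] at hlen
    · have := ih hQ (hs.subset_board hPB) hnil (hdisj.filter _)
        fun R hR => ⟨(key R hR).1, (key R hR).2.1⟩
      omega

/-- If the lower bound is attained, then the first move starts in one of the regions. -/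
theorem Plays.exists_region_of_length_eq {B P : Finset (ℤ × ℤ)} {v : ℤ × ℤ}
    {m : (ℤ × ℤ) × List (ℤ × ℤ)} {ms : List ((ℤ × ℤ) × List (ℤ × ℤ))}
    (h : Plays B P (m :: ms) {v}) (hPB : P ⊆ B) {L : List (Finset (ℤ × ℤ))}
    (hdisj : L.Pairwise Disjoint) (hL : ∀ R ∈ L, IsMersonRegion B R ∧ R ⊆ P)
    (hlen : ms.length < L.length) : ∃ R ∈ L, m.1 ∈ R := by
  by_contra! hout
  obtain - | @⟨_, Q, _, _, _, hm, hplays⟩ := h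
  have hsM := hm.start_mem
  obtain ⟨hne, e, hs⟩ := hm
  have key := fun R hR => hs.region_subset hPB (hL R hR).1 (hL R hR).2 (hout R hR)
  by_cases hnil : ms = []
  · subst hnil
    cases hplays
    obtain ⟨R, hR⟩ := List.exists_mem_of_length_pos hlen
    obtain ⟨r, hr⟩ := (hL R hR).1.1
    have he := Finset.mem_singleton.1 (hs.end_mem hsM)
    have hr' := Finset.mem_singleton.1 ((key R hR).1 hr)
    exact (key R hR).2 (he ▸ hr' ▸ hr)
  · exact hlen.not_ge (hplays.length_regions_le rfl (hs.subset_board hPB) hnil hdisj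
      fun R hR => ⟨(hL R hR).1, (key R hR).1⟩)

/-! ### Positions as bit masks -/

/-- The holes of `Rhombus 6`, numbered row by row. -/
def hole (i : ℕ) : ℤ × ℤ := (((i % 6 : ℕ) : ℤ), ((i / 6 : ℕ) : ℤ))

/-- The position whose pegs are given by the binary digits of `n`. -/
def position (n : ℕ) : Finset (ℤ × ℤ) :=
  ((Finset.range 36).filter fun i => n.testBit i = true).image hole

theorem hole_injective : hole.Injective := fun i j h => by
  simp only [hole, Prod.mk.injEq, Nat.cast_inj] at h
  omega

theorem hole_mem_rhombus {i : ℕ} (hi : i < 36) : hole i ∈ Rhombus 6 := by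
  rw [mem_rhombus_six, hole]
  omega

theorem exists_hole_of_mem_rhombus {p : ℤ × ℤ} (hp : p ∈ Rhombus 6) : ∃ i < 36, hole i = p := by
  obtain ⟨x, y⟩ := p
  rw [mem_rhombus_six] at hp
  refine ⟨(x + 6 * y).toNat, by omega, ?_⟩
  simp only [hole, Prod.mk.injEq]
  omega

theorem hole_mem_position {n i : ℕ} : hole i ∈ position n ↔ i < 36 ∧ n.testBit i = true := by
  simp [position, hole_injective.eq_iff]

theorem position_subset (n : ℕ) : position n ⊆ Rhombus 6 := by
  simp only [position, Finset.image_subset_iff, Finset.mem_filter, Finset.mem_range]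
  exact fun i hi => hole_mem_rhombus hi.1

theorem position_eq_iff {n : ℕ} {P : Finset (ℤ × ℤ)} (hP : P ⊆ Rhombus 6) :
    position n = P ↔ ∀ i < 36, n.testBit i = true ↔ hole i ∈ P := by
  refine ⟨fun h i hi => by rw [← h, hole_mem_position]; simp [hi], fun h => ?_⟩
  ext p
  by_cases hp : p ∈ Rhombus 6
  · obtain ⟨i, hi, rfl⟩ := exists_hole_of_mem_rhombus hp
    rw [hole_mem_position, ← h i hi]
    simp [hi]
  · exact iff_of_false (fun h => hp (position_subset n h)) fun h => hp (hP h)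

theorem position_two_pow {v : ℕ} (hv : v < 36) : position (2 ^ v) = {hole v} := by
  rw [position_eq_iff (Finset.singleton_subset_iff.2 (hole_mem_rhombus hv))]
  intro i _
  simp [Nat.testBit_two_pow, hole_injective.eq_iff, eq_comm]

theorem position_compl_two_pow (v : ℕ) :
    position ((2 ^ 36 - 1) ^^^ 2 ^ v) = (Rhombus 6).erase (hole v) := by
  rw [position_eq_iff (Finset.erase_subset _ _)]
  intro i hi
  rw [Nat.testBit_xor, Nat.testBit_two_pow_sub_one, Nat.testBit_two_pow, Finset.mem_erase,
    hole_injective.ne_iff, decide_eq_true hi, Bool.true_xor, Bool.not_eq_true',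
    decide_eq_false_iff_not, eq_comm, and_iff_left (hole_mem_rhombus hi)]

theorem eq_two_pow_of_position_eq {n v : ℕ} (hn : n < 2 ^ 36) (hv : v < 36)
    (h : position n = {hole v}) : n = 2 ^ v := by
  rw [← position_two_pow hv] at h
  refine Nat.eq_of_testBit_eq fun i => ?_
  by_cases hi : i < 36
  · rw [Bool.eq_iff_iff, (position_eq_iff (position_subset _)).1 h i hi, hole_mem_position]
    simp [hi]
  · have hpow : 2 ^ 36 ≤ 2 ^ i := Nat.pow_le_pow_right (by norm_num) (by omega)
    rw [Nat.testBit_lt_two_pow (hn.trans_le hpow), Nat.testBit_two_pow_of_ne (by omega)]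

/-- The jumps available from hole number `i`: the hole jumped over and the landing hole. -/
def jumpsFrom (i : ℕ) : List (ℕ × ℕ) :=
  (if i % 6 < 4 then [(i + 1, i + 2)] else []) ++
  (if 2 ≤ i % 6 then [(i - 1, i - 2)] else []) ++
  (if i < 24 then [(i + 6, i + 12)] else []) ++
  (if 12 ≤ i then [(i - 6, i - 12)] else []) ++
  (if i % 6 < 4 ∧ i < 24 then [(i + 7, i + 14)] else []) ++
  (if 2 ≤ i % 6 ∧ 12 ≤ i then [(i - 7, i - 14)] else [])

theorem jumpsFrom_lt : ∀ i < 36, ∀ j ∈ jumpsFrom i,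
    j.1 < 36 ∧ j.2 < 36 ∧ i ≠ j.1 ∧ i ≠ j.2 ∧ j.1 ≠ j.2 := by
  decide +kernel

theorem exists_dir_of_mem_jumpsFrom : ∀ i < 36, ∀ j ∈ jumpsFrom i,
    ∃ d ∈ Dirs, hole j.1 = hole i + d ∧ hole j.2 = hole i + d + d := by
  decide +kernel

theorem exists_mem_jumpsFrom : ∀ i < 36, ∀ d ∈ Dirs, hole i + d + d ∈ Rhombus 6 →
    ∃ j ∈ jumpsFrom i, hole j.1 = hole i + d ∧ hole j.2 = hole i + d + d := by
  simp only [mem_rhombus_six]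
  decide +kernel

/-- The holes involved in the jump `j` from `i`. -/
def jumpMask (i : ℕ) (j : ℕ × ℕ) : ℕ := 2 ^ i ||| 2 ^ j.1 ||| 2 ^ j.2

/-- Whether the jump `j` from `i` can be made in the position given by `n`. -/
def canJump (n i : ℕ) (j : ℕ × ℕ) : Bool := Nat.beq (n.land (jumpMask i j)) (2 ^ i ||| 2 ^ j.1)

theorem testBit_jumpMask (i : ℕ) (j : ℕ × ℕ) (a : ℕ) :
    (jumpMask i j).testBit a = true ↔ a = i ∨ a = j.1 ∨ a = j.2 := by
  simp only [jumpMask, Nat.testBit_or, Nat.testBit_two_pow, Bool.or_eq_true, decide_eq_true_eq,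
    or_assoc, eq_comm (b := a)]

theorem canJump_iff {n i : ℕ} {j : ℕ × ℕ} (hi : i < 36) (hj : j ∈ jumpsFrom i) :
    canJump n i j = true ↔
      n.testBit i = true ∧ n.testBit j.1 = true ∧ n.testBit j.2 = false := by
  obtain ⟨-, -, h₁, h₂, h₃⟩ := jumpsFrom_lt i hi j hj
  have hbit (a : ℕ) : (n.land (jumpMask i j)).testBit a = true ↔
      n.testBit a = true ∧ (a = i ∨ a = j.1 ∨ a = j.2) := by
    rw [← testBit_jumpMask]
    exact (Bool.eq_iff_iff.1 (Nat.testBit_and n _ a)).trans (Bool.and_eq_true_iff)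
  rw [canJump, Nat.beq_eq]
  constructor
  · intro h
    simp only [h, Nat.testBit_or, Nat.testBit_two_pow, Bool.or_eq_true, decide_eq_true_eq] at hbit
    have hi' := hbit i
    have hj₁ := hbit j.1
    have hj₂ := hbit j.2
    grind
  · rintro ⟨hi', hj₁, hj₂⟩
    refine Nat.eq_of_testBit_eq fun a => ?_
    rw [Bool.eq_iff_iff, hbit]
    simp only [Nat.testBit_or, Nat.testBit_two_pow, Bool.or_eq_true, decide_eq_true_eq]
    grind

theorem jumpOK_iff_canJump {n i : ℕ} {j : ℕ × ℕ} {d : ℤ × ℤ} (hi : i < 36)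
    (hj : j ∈ jumpsFrom i) (hd : d ∈ Dirs) (h₁ : hole j.1 = hole i + d)
    (h₂ : hole j.2 = hole i + d + d) :
    JumpOK (Rhombus 6) (position n) (hole i) d ↔ canJump n i j = true := by
  obtain ⟨hj₁, hj₂, -⟩ := jumpsFrom_lt i hi j hj
  rw [JumpOK, ← h₂, ← h₁, canJump_iff hi hj]
  simp [hole_mem_position, hd, hi, hj₁, hj₂, hole_mem_rhombus hj₂]

theorem jumpResult_position {n i : ℕ} {j : ℕ × ℕ} {d : ℤ × ℤ} (hi : i < 36)
    (hj : j ∈ jumpsFrom i) (h₁ : hole j.1 = hole i + d) (h₂ : hole j.2 = hole i + d + d)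
    (h : canJump n i j = true) :
    jumpResult (position n) (hole i) d = position (n.xor (jumpMask i j)) := by
  obtain ⟨hj₁, hj₂, hne₁, hne₂, hne₃⟩ := jumpsFrom_lt i hi j hj
  obtain ⟨hb, hb₁, hb₂⟩ := (canJump_iff hi hj).1 h
  rw [jumpResult, ← h₂, ← h₁, eq_comm, position_eq_iff]
  · intro a ha
    have hxor : (n.xor (jumpMask i j)).testBit a = (n.testBit a ^^ (jumpMask i j).testBit a) :=
      Nat.testBit_xor n _ a
    have hmask := testBit_jumpMask i j a
    simp only [hxor, Finset.mem_union, Finset.mem_sdiff, Finset.mem_insert, Finset.mem_singleton,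
      hole_injective.eq_iff, hole_mem_position, ha, true_and]
    grind
  · exact Finset.union_subset (Finset.sdiff_subset.trans (position_subset n))
      (Finset.singleton_subset_iff.2 (hole_mem_rhombus hj₂))

theorem xor_jumpMask_lt {n i : ℕ} {j : ℕ × ℕ} (hn : n < 2 ^ 36) (hi : i < 36)
    (hj : j ∈ jumpsFrom i) : n.xor (jumpMask i j) < 2 ^ 36 := by
  obtain ⟨hj₁, hj₂, -⟩ := jumpsFrom_lt i hi j hj
  have hpow {a : ℕ} (ha : a < 36) : 2 ^ a < 2 ^ 36 := Nat.pow_lt_pow_right (by norm_num) ha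
  exact Nat.xor_lt_two_pow hn
    (Nat.or_lt_two_pow (Nat.or_lt_two_pow (hpow hi) (hpow hj₁)) (hpow hj₂))

/-! ### Replaying solutions -/

/-- The position reached from `n` when the peg in hole number `i` jumps successively to the
listed holes, if these jumps are legal. -/
def replayMove (n i : ℕ) : List ℕ → Option ℕ
  | [] => some n
  | k :: ks => ((jumpsFrom i).find? fun j => j.2 == k && canJump n i j).bind fun j =>
      replayMove (n.xor (jumpMask i j)) k ks

/-- The position reached from `n` by the given moves, each a starting hole followed by the
successive landing holes. -/
def replay (n : ℕ) : List (ℕ × List ℕ) → Option ℕ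
  | [] => some n
  | m :: ms => bif m.1 < 36 && m.2 != [] then (replayMove n m.1 m.2).bind fun q => replay q ms
      else none

theorem exists_sweepFrom_of_replayMove {ks : List ℕ} {n i q : ℕ} (hi : i < 36)
    (h : replayMove n i ks = some q) :
    ∃ ds e, ds.length = ks.length ∧
      SweepFrom (Rhombus 6) (position n) (hole i) ds e (position q) := by
  induction ks generalizing n i with
  | nil =>
    obtain rfl := Option.some.inj h
    exact ⟨[], _, rfl, .nil _ _⟩
  | cons k ks ih =>
    obtain ⟨j, hfind, hrest⟩ := Option.bind_eq_some_iff.1 h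
    have hj := List.mem_of_find?_eq_some hfind
    have hcan := List.find?_some hfind
    simp only [Bool.and_eq_true, beq_iff_eq] at hcan
    obtain ⟨rfl, hcan⟩ := hcan
    obtain ⟨ds, e, hlen, hs⟩ := ih (jumpsFrom_lt i hi j hj).2.1 hrest
    obtain ⟨d, hd, h₁, h₂⟩ := exists_dir_of_mem_jumpsFrom i hi j hj
    refine ⟨d :: ds, e, by simp [hlen], .cons ((jumpOK_iff_canJump hi hj hd h₁ h₂).2 hcan) ?_⟩
    rwa [jumpResult_position hi hj h₁ h₂ hcan, ← h₂]

theorem exists_plays_of_replay {ms : List (ℕ × List ℕ)} {n q : ℕ} (h : replay n ms = some q) :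
    ∃ ms', ms'.length = ms.length ∧ Plays (Rhombus 6) (position n) ms' (position q) := by
  induction ms generalizing n with
  | nil =>
    obtain rfl := Option.some.inj h
    exact ⟨[], rfl, .nil _⟩
  | cons m ms ih =>
    rw [replay] at h
    cases hm : (decide (m.1 < 36) && m.2 != []) with
    | false => simp [hm] at h
    | true =>
      rw [hm, cond_true] at h
      obtain ⟨n', hmove, hrest⟩ := Option.bind_eq_some_iff.1 h
      simp only [Bool.and_eq_true, decide_eq_true_eq, bne_iff_ne, ne_eq] at hm
      obtain ⟨ds, e, hlen, hs⟩ := exists_sweepFrom_of_replayMove hm.1 hmove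
      obtain ⟨ms', hlen', hp⟩ := ih hrest
      refine ⟨(hole m.1, ds) :: ms', by simp [hlen'], .cons ⟨?_, e, hs⟩ hp⟩
      rintro rfl
      exact hm.2 (List.length_eq_zero_iff.1 hlen.symm)

/-! ### Exhaustive search for short solutions

The search is written with recursors, which the kernel evaluates faster than compiled recursion. -/

/-- `List.foldr`, by the recursor. -/
noncomputable def foldList {α β : Type} (f : α → β → β) (b : β) (l : List α) : β :=
  List.rec b (fun a _ ih => f a ih) l

/-- `f n`, with `n` evaluated first. -/
noncomputable def applyEvaluated {α : Type} (n : ℕ) (f : ℕ → α) : α :=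
  Nat.rec (f 0) (fun m _ => f (Nat.succ m)) n

theorem applyEvaluated_eq {α : Type} (n : ℕ) (f : ℕ → α) : applyEvaluated n f = f n := by
  cases n <;> rfl

theorem subset_foldList {α β : Type} {f : α → List β → List β} (hf : ∀ a l, l ⊆ f a l)
    (b : List β) (l : List α) : b ⊆ foldList f b l := by
  induction l with
  | nil => exact List.Subset.refl b
  | cons a l ih => exact List.Subset.trans ih (hf a _)

theorem foldList_of_mem {α β : Type} {f : α → List β → List β} {A : List β → Prop}
    (hA : ∀ l l', l ⊆ l' → A l → A l') (hf : ∀ a l, l ⊆ f a l) {a : α} {l : List α} (ha : a ∈ l)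
    (hfa : ∀ l, A (f a l)) (b : List β) : A (foldList f b l) := by
  induction l with
  | nil => simp at ha
  | cons c l ih =>
    obtain rfl | ha := List.mem_cons.1 ha
    · exact hfa _
    · exact hA _ _ (hf c _) (ih ha)

/-- The corners, and the other boundary holes in adjacent pairs. -/
def perimeterRegions : List (List ℕ) :=
  [[0], [5], [30], [35], [1, 2], [3, 4], [31, 32], [33, 34], [6, 12], [18, 24], [11, 17], [23, 29]]

/-- Hole number `i` with its six neighbors. -/
def hexagon (i : ℕ) : List ℕ := [i, i - 1, i + 1, i - 6, i + 6, i - 7, i + 7]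

/-- The hexagons that avoid the boundary. -/
def hexRegions : List (List ℕ) := [hexagon 14, hexagon 15, hexagon 20, hexagon 21]

/-- The holes with numbers in `r`. -/
def regionHoles (r : List ℕ) : Finset (ℤ × ℤ) := (r.map hole).toFinset

theorem hole_mem_regionHoles {r : List ℕ} {i : ℕ} : hole i ∈ regionHoles r ↔ i ∈ r := by
  simp [regionHoles, hole_injective.eq_iff]

theorem regions_nonempty_lt :
    ∀ r ∈ hexRegions ++ perimeterRegions, r ≠ [] ∧ ∀ i ∈ r, i < 36 := by
  decide +kernel

theorem regions_jumps : ∀ r ∈ hexRegions ++ perimeterRegions, ∀ i < 36, ∀ j ∈ jumpsFrom i,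
    j.1 ∈ r → i ∈ r ∨ j.2 ∈ r := by
  decide +kernel

theorem isMersonRegion_regionHoles {r : List ℕ} (hr : r ∈ hexRegions ++ perimeterRegions) :
    IsMersonRegion (Rhombus 6) (regionHoles r) := by
  constructor
  · obtain ⟨i, hi⟩ := List.exists_mem_of_ne_nil r (regions_nonempty_lt r hr).1
    exact ⟨hole i, hole_mem_regionHoles.2 hi⟩
  · intro p hp d hd hland hover
    obtain ⟨i, hi, rfl⟩ := exists_hole_of_mem_rhombus hp
    obtain ⟨j, hj, h₁, h₂⟩ := exists_mem_jumpsFrom i hi d hd hland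
    rw [← h₁, hole_mem_regionHoles] at hover
    rw [← h₂, hole_mem_regionHoles, hole_mem_regionHoles]
    exact regions_jumps r hr i hi j hj hover

theorem perimeterRegions_pairwise :
    perimeterRegions.Pairwise fun r t => ∀ i ∈ r, i ∉ t := by
  decide +kernel

theorem hexRegions_disjoint_perimeterRegions :
    ∀ r ∈ hexRegions, ∀ t ∈ perimeterRegions, ∀ i ∈ r, i ∉ t := by
  decide +kernel

theorem disjoint_regionHoles {r t : List ℕ} (h : ∀ i ∈ r, i ∉ t) :
    Disjoint (regionHoles r) (regionHoles t) := by
  rw [Finset.disjoint_left]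
  intro p hp
  obtain ⟨i, hi, rfl⟩ := List.mem_map.1 (List.mem_toFinset.1 hp)
  rw [hole_mem_regionHoles]
  exact h i hi

/-- The bit mask of a list of holes. -/
def regionMask (r : List ℕ) : ℕ := r.foldr (fun i m => 2 ^ i ||| m) 0

/-- Whether all the holes with numbers in `r` are occupied. -/
def isFull (n : ℕ) (r : List ℕ) : Bool := Nat.beq (n.land (regionMask r)) (regionMask r)

theorem testBit_regionMask (r : List ℕ) (a : ℕ) : (regionMask r).testBit a = true ↔ a ∈ r := by
  induction r with
  | nil => simp [regionMask]
  | cons i r ih =>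
    rw [regionMask, List.foldr_cons, Nat.testBit_or, Nat.testBit_two_pow, Bool.or_eq_true,
      decide_eq_true_eq, List.mem_cons, eq_comm]
    exact or_congr Iff.rfl ih

theorem testBit_of_isFull {n i : ℕ} {r : List ℕ} (h : isFull n r = true) (hi : i ∈ r) :
    n.testBit i = true := by
  rw [isFull, Nat.beq_eq] at h
  have hbit : (n.land (regionMask r)).testBit i = (n.testBit i && (regionMask r).testBit i) :=
    Nat.testBit_and n _ i
  rw [h, (testBit_regionMask r i).2 hi, Bool.and_true] at hbit
  exact hbit.symm

theorem regionHoles_subset_position {n : ℕ} {r : List ℕ}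
    (hr : r ∈ hexRegions ++ perimeterRegions) (h : isFull n r = true) :
    regionHoles r ⊆ position n := by
  intro p hp
  obtain ⟨i, hi, rfl⟩ := List.mem_map.1 (List.mem_toFinset.1 hp)
  exact hole_mem_position.2 ⟨(regions_nonempty_lt r hr).2 i hi, testBit_of_isFull h hi⟩

/-- Disjoint full regions of the position given by `n`. -/
def fullRegions (n : ℕ) : List (List ℕ) :=
  (hexRegions.find? (isFull n)).toList ++ perimeterRegions.filter (isFull n)

theorem mem_of_mem_fullRegions {n : ℕ} {r : List ℕ} (h : r ∈ fullRegions n) :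
    r ∈ hexRegions ++ perimeterRegions ∧ isFull n r = true := by
  rw [fullRegions, List.mem_append, Option.mem_toList, List.mem_filter] at h
  rw [List.mem_append]
  obtain h | h := h
  · exact ⟨.inl (List.mem_of_find?_eq_some h), List.find?_some h⟩
  · exact ⟨.inr h.1, h.2⟩

theorem fullRegions_pairwise_disjoint (n : ℕ) :
    ((fullRegions n).map regionHoles).Pairwise Disjoint := by
  rw [List.pairwise_map, fullRegions, List.pairwise_append]
  refine ⟨?_, (perimeterRegions_pairwise.filter _).imp disjoint_regionHoles, fun r hr t ht => ?_⟩
  · cases hexRegions.find? (isFull n) <;> simp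
  · exact disjoint_regionHoles (hexRegions_disjoint_perimeterRegions r
      (List.mem_of_find?_eq_some (Option.mem_toList.1 hr)) t (List.mem_filter.1 ht).1)

theorem isMersonRegion_of_mem_fullRegions {n : ℕ} :
    ∀ R ∈ (fullRegions n).map regionHoles, IsMersonRegion (Rhombus 6) R ∧ R ⊆ position n := by
  intro R hR
  obtain ⟨r, hr, rfl⟩ := List.mem_map.1 hR
  obtain ⟨hr, hfull⟩ := mem_of_mem_fullRegions hr
  exact ⟨isMersonRegion_regionHoles hr, regionHoles_subset_position hr hfull⟩

/-- The number of full regions in `fullRegions n`. -/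
noncomputable def regionCount (n : ℕ) : ℕ :=
  foldList (fun r c => bif isFull n r then Nat.succ c else c)
    (foldList (fun r c => bif isFull n r then 1 else c) 0 hexRegions) perimeterRegions

theorem regionCount_eq (n : ℕ) : regionCount n = (fullRegions n).length := by
  have hfind (l : List (List ℕ)) : foldList (fun r c => bif isFull n r then 1 else c) 0 l =
      (l.find? (isFull n)).toList.length := by
    induction l with
    | nil => rfl
    | cons r l ih =>
      rw [List.find?_cons]
      change (bif isFull n r then 1 else foldList _ 0 l) = _
      cases isFull n r <;> simp [ih]
  have hfilter (b : ℕ) (l : List (List ℕ)) :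
      foldList (fun r c => bif isFull n r then Nat.succ c else c) b l =
        b + (l.filter (isFull n)).length := by
    induction l with
    | nil => rfl
    | cons r l ih =>
      change (bif isFull n r then Nat.succ (foldList _ b l) else foldList _ b l) = _
      rw [List.filter_cons]
      cases isFull n r <;> simp [ih, Nat.add_assoc]
  rw [regionCount, fullRegions, hfilter, hfind, List.length_append]

/-- Adds to a list the positions satisfying `keep` that result from moves of the peg in hole `i`.
If such a move is longer than `fuel`, then `goal` is added as well. -/
noncomputable def sweepResults (goal : ℕ) (keep : ℕ → Bool) (fuel : ℕ) :
    ℕ → ℕ → List ℕ → List ℕ :=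
  Nat.rec (fun _ _ l => goal :: l)
    (fun _ ih n i l => foldList
      (fun j l => bif canJump n i j then
          applyEvaluated (n.xor (jumpMask i j)) fun q =>
            bif keep q then q :: ih q j.2 l else ih q j.2 l
        else l)
      l (jumpsFrom i)) fuel

theorem sweepResults_succ (goal : ℕ) (keep : ℕ → Bool) (fuel n i : ℕ) (l : List ℕ) :
    sweepResults goal keep (fuel + 1) n i l = foldList
      (fun j l => bif canJump n i j then
          applyEvaluated (n.xor (jumpMask i j)) fun q =>
            bif keep q then q :: sweepResults goal keep fuel q j.2 l
              else sweepResults goal keep fuel q j.2 l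
        else l)
      l (jumpsFrom i) :=
  rfl

theorem subset_sweepResults_step {goal : ℕ} {keep : ℕ → Bool} {fuel : ℕ}
    (h : ∀ n i l, l ⊆ sweepResults goal keep fuel n i l) (n i : ℕ) (j : ℕ × ℕ) (l : List ℕ) :
    l ⊆ bif canJump n i j then
          applyEvaluated (n.xor (jumpMask i j)) fun q =>
            bif keep q then q :: sweepResults goal keep fuel q j.2 l
              else sweepResults goal keep fuel q j.2 l
        else l := by
  rw [applyEvaluated_eq]
  cases canJump n i j
  · exact List.Subset.refl l
  · cases keep (n.xor (jumpMask i j))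
    · exact h _ _ _
    · exact List.Subset.trans (h _ _ _) (List.subset_cons_self _ _)

theorem subset_sweepResults (goal : ℕ) (keep : ℕ → Bool) (fuel n i : ℕ) (l : List ℕ) :
    l ⊆ sweepResults goal keep fuel n i l := by
  induction fuel generalizing n i l with
  | zero => exact List.subset_cons_self goal l
  | succ fuel ih => exact subset_foldList (subset_sweepResults_step ih n i) l (jumpsFrom i)

theorem SweepFrom.exists_mem_sweepResults {Q : Finset (ℤ × ℤ)} {e : ℤ × ℤ} {ds : List (ℤ × ℤ)}
    (goal : ℕ) (keep : ℕ → Bool) (fuel : ℕ) {n i : ℕ} (hn : n < 2 ^ 36) (hi : i < 36)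
    (hds : ds ≠ []) (h : SweepFrom (Rhombus 6) (position n) (hole i) ds e Q) :
    ∃ q < 2 ^ 36, Q = position q ∧ ∀ l, goal ∈ sweepResults goal keep fuel n i l ∨
      (keep q = true → q ∈ sweepResults goal keep fuel n i l) := by
  induction ds generalizing fuel n i with
  | nil => exact absurd rfl hds
  | cons d ds ih =>
    obtain - | ⟨hjump, hrest⟩ := h
    obtain ⟨j, hj, h₁, h₂⟩ := exists_mem_jumpsFrom i hi d hjump.1 hjump.2.2.2.1
    have hcan := (jumpOK_iff_canJump hi hj hjump.1 h₁ h₂).1 hjump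
    rw [jumpResult_position hi hj h₁ h₂ hcan, ← h₂] at hrest
    have hlt := xor_jumpMask_lt hn hi hj
    have lift {q : ℕ} (hq : ∀ fuel' l, fuel = fuel' + 1 →
        goal ∈ sweepResults goal keep fuel' (n.xor (jumpMask i j)) j.2 l ∨ (keep q = true →
          q = n.xor (jumpMask i j) ∨
            q ∈ sweepResults goal keep fuel' (n.xor (jumpMask i j)) j.2 l)) (l : List ℕ) :
        goal ∈ sweepResults goal keep fuel n i l ∨
          (keep q = true → q ∈ sweepResults goal keep fuel n i l) := by
      cases fuel with
      | zero => exact .inl List.mem_cons_self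
      | succ fuel =>
        rw [sweepResults_succ]
        refine foldList_of_mem (A := fun l => goal ∈ l ∨ (keep q = true → q ∈ l))
          (fun l l' hl => Or.imp (@hl _) fun h hk => hl (h hk))
          (subset_sweepResults_step (subset_sweepResults goal keep fuel) n i) hj (fun l => ?_) l
        rw [hcan, cond_true, applyEvaluated_eq]
        have := hq fuel l rfl
        cases hk : keep (n.xor (jumpMask i j))
        · rw [cond_false]
          refine this.imp_right fun h hkq => (h hkq).resolve_left ?_
          rintro rfl
          exact absurd (hk.symm.trans hkq) Bool.false_ne_true
        · rw [cond_true, List.mem_cons, List.mem_cons]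
          exact this.imp .inr id
    by_cases hnil : ds = []
    · subst hnil
      cases hrest
      exact ⟨_, hlt, rfl, lift fun _ _ _ => .inr fun _ => .inl rfl⟩
    · cases fuel with
      | zero =>
        obtain ⟨q, hq, hQ, -⟩ := ih 0 hlt (jumpsFrom_lt i hi j hj).2.1 hnil hrest
        exact ⟨q, hq, hQ, fun l => .inl List.mem_cons_self⟩
      | succ fuel =>
        obtain ⟨q, hq, hQ, hmem⟩ := ih fuel hlt (jumpsFrom_lt i hi j hj).2.1 hnil hrest
        refine ⟨q, hq, hQ, lift fun fuel' l hfuel => ?_⟩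
        obtain rfl := Nat.succ.inj hfuel
        exact (hmem l).imp_right fun h hk => .inr (h hk)

/-- Removes duplicates. -/
noncomputable def removeDuplicates (l : List ℕ) : List ℕ :=
  foldList (fun x l => bif foldList (fun y b => bif Nat.beq x y then true else b) false l
    then l else x :: l) [] l

theorem mem_of_foldList_beq {x : ℕ} {l : List ℕ}
    (h : foldList (fun y b => bif Nat.beq x y then true else b) false l = true) : x ∈ l := by
  induction l with
  | nil => exact absurd h Bool.false_ne_true
  | cons y l ih =>
    change (bif Nat.beq x y then true else _) = true at h
    cases hxy : Nat.beq x y with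
    | true => exact Nat.eq_of_beq_eq_true hxy ▸ List.mem_cons_self
    | false =>
      rw [hxy] at h
      exact List.mem_cons_of_mem _ (ih h)

theorem mem_removeDuplicates {x : ℕ} {l : List ℕ} (hx : x ∈ l) : x ∈ removeDuplicates l := by
  refine foldList_of_mem (A := fun l => x ∈ l) (fun _ _ h => @h _) (fun a l => ?_) hx
    (fun l => ?_) []
  · cases foldList (fun y b => bif Nat.beq a y then true else b) false l
    · exact List.subset_cons_self a l
    · exact List.Subset.refl l
  · cases h : foldList (fun y b => bif Nat.beq x y then true else b) false l
    · exact List.mem_cons_self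
    · exact mem_of_foldList_beq h

/-- Whether `n` should be examined with `k` moves left. -/
noncomputable def isCandidate (goal k n : ℕ) : Bool :=
  bif Nat.ble (regionCount n) k then true else Nat.beq n goal

/-- The candidates reached from the positions in `l` by moves starting in full regions. -/
noncomputable def successors (goal k : ℕ) (l : List ℕ) : List ℕ :=
  foldList (fun n acc => foldList (fun r acc => bif isFull n r then
      foldList (fun i acc => sweepResults goal (isCandidate goal k) 36 n i acc) acc r
    else acc) acc (hexRegions ++ perimeterRegions)) [] l

/-- Whether all positions in `l` differ from `goal` and have at least `k` full regions. -/
noncomputable def allTight (goal k : ℕ) (l : List ℕ) : Bool :=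
  foldList (fun n b => bif Nat.beq n goal then false else
    bif Nat.ble k (regionCount n) then b else false) true l

/-- Checks that `goal` cannot be reached in `k` moves or fewer from the positions in `l`. -/
noncomputable def unsolvable (goal k : ℕ) : List ℕ → Bool :=
  Nat.rec (allTight goal 0)
    (fun k ih l => bif allTight goal (k + 1) l then ih (removeDuplicates (successors goal k l))
      else false) k

theorem allTight_iff {goal k : ℕ} {l : List ℕ} :
    allTight goal k l = true ↔ ∀ n ∈ l, n ≠ goal ∧ k ≤ regionCount n := by
  induction l with
  | nil => simp [allTight, foldList]
  | cons n l ih =>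
    change (bif Nat.beq n goal then false else
      bif Nat.ble k (regionCount n) then allTight goal k l else false) = true ↔ _
    rw [List.forall_mem_cons, ← ih, ← Nat.ble_eq, ne_eq, ← Nat.beq_eq]
    cases Nat.beq n goal <;> cases Nat.ble k (regionCount n) <;> simp

theorem allTight_of_unsolvable {goal k : ℕ} {l : List ℕ} (h : unsolvable goal k l = true) :
    allTight goal k l = true := by
  cases k with
  | zero => exact h
  | succ k =>
    change (bif allTight goal (k + 1) l then _ else false) = true at h
    cases hl : allTight goal (k + 1) l
    · rw [hl] at h
      exact h
    · rfl

theorem mem_successors {goal k n i : ℕ} {l r : List ℕ} {A : List ℕ → Prop}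
    (hA : ∀ l l', l ⊆ l' → A l → A l') (hn : n ∈ l) (hr : r ∈ hexRegions ++ perimeterRegions)
    (hfull : isFull n r = true) (hi : i ∈ r)
    (h : ∀ acc, A (sweepResults goal (isCandidate goal k) 36 n i acc)) :
    A (successors goal k l) := by
  have hsweep (n i : ℕ) (acc : List ℕ) := subset_sweepResults goal (isCandidate goal k) 36 n i acc
  have hregion (n : ℕ) (r acc : List ℕ) : acc ⊆ bif isFull n r then
      foldList (fun i acc => sweepResults goal (isCandidate goal k) 36 n i acc) acc r
      else acc := by
    cases isFull n r
    · exact List.Subset.refl acc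
    · exact subset_foldList (hsweep n) acc r
  refine foldList_of_mem hA (fun n acc => subset_foldList (hregion n) acc _) hn (fun acc => ?_) []
  refine foldList_of_mem hA (hregion n) hr (fun acc => ?_) acc
  rw [hfull, cond_true]
  exact foldList_of_mem hA (hsweep n) hi h acc

theorem lt_length_of_unsolvable {v k : ℕ} (hv : v < 36) {l : List ℕ}
    (h : unsolvable (2 ^ v) k l = true) {n : ℕ} (hn : n ∈ l) (hlt : n < 2 ^ 36)
    {ms : List ((ℤ × ℤ) × List (ℤ × ℤ))} (hms : Plays (Rhombus 6) (position n) ms {hole v}) :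
    k < ms.length := by
  have hgoal := (allTight_iff.1 (allTight_of_unsolvable h) n hn).1
  induction k generalizing l n ms with
  | zero =>
    refine List.length_pos_iff.2 fun hnil => ?_
    subst hnil
    generalize hP : position n = P at hms
    generalize hQ : ({hole v} : Finset (ℤ × ℤ)) = Q at hms
    cases hms
    exact hgoal (eq_two_pow_of_position_eq hlt hv (hP.trans hQ.symm))
  | succ k ih =>
    have htight := allTight_of_unsolvable h
    have hnext : unsolvable (2 ^ v) k (removeDuplicates (successors (2 ^ v) k l)) = true := by
      change (bif allTight (2 ^ v) (k + 1) l then _ else false) = true at h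
      rwa [htight, cond_true] at h
    have hnext' := allTight_iff.1 (allTight_of_unsolvable hnext)
    have hcount := (allTight_iff.1 htight n hn).2
    generalize hQ : ({hole v} : Finset (ℤ × ℤ)) = Q at hms
    cases ms with
    | nil =>
      generalize hP : position n = P at hms
      cases hms
      exact absurd (eq_two_pow_of_position_eq hlt hv (hP.trans hQ.symm)) hgoal
    | cons m ms =>
      subst hQ
      rw [List.length_cons, Nat.add_lt_add_iff_right]
      by_contra! hlen
      obtain ⟨R, hR, hmR⟩ := hms.exists_region_of_length_eq (position_subset n)
        (fullRegions_pairwise_disjoint n) isMersonRegion_of_mem_fullRegions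
        (by rw [List.length_map, ← regionCount_eq]; omega)
      obtain ⟨r, hr, rfl⟩ := List.mem_map.1 hR
      obtain ⟨hr, hfull⟩ := mem_of_mem_fullRegions hr
      obtain ⟨i, hi, him⟩ := List.mem_map.1 (List.mem_toFinset.1 hmR)
      generalize hQ : ({hole v} : Finset (ℤ × ℤ)) = Q at hms
      obtain - | ⟨⟨hne, e, hs⟩, hplays⟩ := hms
      subst hQ
      rw [← him] at hs
      obtain ⟨q, hq, rfl, hmem⟩ := hs.exists_mem_sweepResults (2 ^ v) (isCandidate (2 ^ v) k) 36
        hlt ((regions_nonempty_lt r hr).2 i hi) hne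
      have hsucc := mem_successors
        (A := fun l => 2 ^ v ∈ l ∨ (isCandidate (2 ^ v) k q = true → q ∈ l))
        (fun l l' hl => Or.imp (@hl _) fun h hk => hl (h hk)) hn hr hfull hi hmem
      obtain hbad | hsucc := hsucc
      · exact (hnext' _ (mem_removeDuplicates hbad)).1 rfl
      · cases hk : isCandidate (2 ^ v) k q with
        | true =>
          have hq' := mem_removeDuplicates (hsucc hk)
          exact (ih hnext hq' hq hplays (hnext' q hq').1).not_ge hlen
        | false =>
          rw [isCandidate] at hk
          cases hble : Nat.ble (regionCount q) k with
          | true => simp [hble] at hk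
          | false =>
            rw [hble, cond_false] at hk
            have hms : ms ≠ [] := by
              rintro rfl
              generalize hP : position q = P at hplays
              generalize hQ : ({hole v} : Finset (ℤ × ℤ)) = Q at hplays
              cases hplays
              rw [eq_two_pow_of_position_eq hq hv (hP.trans hQ.symm), Nat.beq_refl] at hk
              exact absurd hk (by simp)
            have := hplays.length_regions_le rfl (position_subset q) hms
              (fullRegions_pairwise_disjoint q) isMersonRegion_of_mem_fullRegions
            rw [List.length_map, ← regionCount_eq] at this
            have hgt : ¬ regionCount q ≤ k := fun h =>
              absurd (hble.symm.trans (Nat.ble_eq_true_of_le h)) Bool.false_ne_true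
            omega

/-! ### All complement problems -/

/-- Solutions in the format of `replay` for one hole of each symmetry class. -/
def solutions : List (ℕ × List (ℕ × List ℕ)) :=
  [(0, [(12, [0]), (20, [6]), (15, [13]), (32, [20]), (0, [12, 14, 26]), (24, [12]), (34, [20,
      32, 18, 6]), (17, [15, 27]), (30, [32, 34, 20]), (2, [0, 12, 26, 14, 2, 16]), (29, [17,
      15]), (5, [17]), (35, [21, 23, 11, 9]), (4, [2, 16, 14, 0])]),
   (6, [(18, [6]), (30, [18]), (0, [12, 24]), (20, [6]), (32, [30, 18]), (34, [32, 20, 34]),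
      (15, [27]), (17, [15, 13]), (2, [14, 12, 24, 26, 12, 0, 14]), (35, [33, 21, 7]), (4, [2,
      0, 14]), (5, [17, 3, 15, 13]), (23, [35, 21]), (22, [20, 6])]),
   (12, [(0, [12]), (18, [6]), (2, [0, 12]), (15, [1]), (29, [15]), (20, [22, 8, 6, 18, 20]),
      (30, [18]), (33, [19, 21, 7]), (4, [2, 0, 14, 12, 24, 26]), (35, [33, 21]), (17, [3,
      15]), (5, [17, 29, 27]), (31, [33, 19]), (16, [14, 28, 26, 12])]),
   (18, [(30, [18]), (12, [24]), (0, [12]), (32, [30, 18, 6]), (2, [0, 12]), (15, [1]), (29,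
      [15]), (20, [22, 8, 20, 32, 18, 6, 20]), (4, [2, 0, 14, 26]), (17, [3, 15]), (5, [17,
      29]), (35, [23, 9, 21]), (34, [32, 20, 22, 34, 20, 18])]),
   (24, [(12, [24]), (30, [18]), (0, [12, 24]), (20, [6]), (15, [13]), (2, [0, 12, 14]), (34,
      [20]), (29, [27, 15, 1, 13, 27]), (32, [34, 20, 18, 30, 32, 20]), (17, [15, 13, 27]), (5,
      [17, 29]), (35, [23, 21]), (3, [15]), (4, [16, 14, 28, 26, 24])]),
   (30, [(18, [30]), (6, [18]), (20, [6]), (0, [12, 24]), (15, [13]), (29, [15]), (32, [20,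
      6]), (2, [0, 12, 26]), (4, [2, 14]), (30, [18, 32, 20, 22, 8]), (17, [3, 15, 13, 1, 15]),
      (5, [17, 29]), (35, [23, 9, 21]), (34, [22, 20, 34, 32, 30])]),
   (7, [(21, [7]), (0, [14]), (23, [21, 7]), (35, [21]), (2, [14, 28]), (34, [22, 8]), (32,
      [34]), (12, [14, 0, 2]), (11, [23, 35, 33, 21]), (3, [15, 17, 3, 1]), (24, [12, 0, 2]),
      (5, [3, 1, 15, 27, 13]), (30, [32]), (19, [31, 33, 19, 7])]),
   (13, [(1, [13]), (21, [7]), (12, [14]), (3, [1, 13]), (33, [21, 7]), (35, [33]), (24, [12,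
      14, 2]), (5, [3, 1, 13, 27]), (32, [34, 20, 18, 32, 20]), (23, [35, 21, 19]), (0, [12,
      26]), (30, [32, 20]), (11, [23, 21]), (15, [17, 3, 15, 27, 13])]),
   (19, [(33, [19]), (14, [26]), (2, [14]), (18, [20, 8]), (35, [33, 19]), (30, [18, 20]), (4,
      [2, 14, 26, 24]), (6, [20, 34]), (32, [30, 18, 6, 8]), (29, [27]), (0, [2, 14, 28, 26]),
      (17, [29]), (5, [17]), (9, [11, 23, 21, 9, 23, 35, 33, 19])]),
   (25, [(13, [25]), (15, [13]), (33, [19]), (12, [26]), (35, [33, 19]), (0, [12, 14, 26]),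
      (18, [20, 34]), (3, [15, 27]), (23, [21, 33, 35, 23, 9]), (2, [0, 14, 2, 16]), (31,
      [33]), (30, [18, 32, 34, 22]), (11, [23, 21]), (5, [3, 17, 15, 27, 25])]),
   (14, [(2, [14]), (20, [8]), (4, [2, 14]), (17, [3]), (34, [20, 8, 10]), (23, [9]), (12, [14,
      16, 4, 2, 16]), (35, [23, 9]), (0, [2, 16]), (24, [12, 0, 14]), (32, [18, 20]), (5, [17,
      15, 13, 27, 29, 15, 27]), (30, [32, 34, 20]), (26, [14])]),
   (20, [(34, [20]), (15, [27]), (1, [15]), (32, [34]), (30, [32]), (23, [21, 33, 31]), (6, [8,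
      22]), (18, [30, 32, 18, 6]), (35, [23, 21, 7]), (0, [12, 14]), (3, [1, 13, 25, 27, 29]),
      (5, [3, 15, 13, 27]), (11, [23, 35, 33, 21]), (10, [22, 20])])]

theorem replay_solutions : ∀ s ∈ solutions, s.1 < 36 ∧ s.2.length ≤ 14 ∧
    replay ((2 ^ 36 - 1) ^^^ 2 ^ s.1) s.2 = some (2 ^ s.1) := by
  decide +kernel

set_option maxRecDepth 100000 in
theorem unsolvable_solutions : ∀ s ∈ solutions,
    unsolvable (2 ^ s.1) 12 [(2 ^ 36 - 1) ^^^ 2 ^ s.1] = true := by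
  decide +kernel

theorem exists_complementSolvable {s : ℕ × List (ℕ × List ℕ)} (hs : s ∈ solutions) :
    ∃ k ≤ 14, ComplementSolvable (hole s.1) k := by
  obtain ⟨hlt, hlen, hreplay⟩ := replay_solutions s hs
  obtain ⟨ms, hms, hplays⟩ := exists_plays_of_replay hreplay
  rw [position_compl_two_pow, position_two_pow hlt] at hplays
  exact ⟨s.2.length, hlen, ms, hplays, hms⟩

theorem thirteen_le_of_complementSolvable {s : ℕ × List (ℕ × List ℕ)} (hs : s ∈ solutions)
    {k : ℕ} (h : ComplementSolvable (hole s.1) k) : 13 ≤ k := by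
  obtain ⟨ms, hplays, rfl⟩ := h
  have hlt := (replay_solutions s hs).1
  rw [← position_compl_two_pow] at hplays
  exact lt_length_of_unsolvable hlt (unsolvable_solutions s hs) List.mem_cons_self
    (Nat.xor_lt_two_pow (by norm_num) (Nat.pow_lt_pow_right (by norm_num) hlt)) hplays

theorem exists_solution_symmetric : ∀ i < 36, ∃ s ∈ solutions,
    hole i = hole s.1 ∨ hole i = (hole s.1).swap ∨ hole i = (5, 5) - hole s.1 ∨
      hole i = ((5, 5) - hole s.1).swap := by
  decide +kernel

theorem complementSolvable_swap_iff {v : ℤ × ℤ} {k : ℕ} :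
    ComplementSolvable v.swap k ↔ ComplementSolvable v k :=
  ⟨fun h => v.swap_swap ▸ h.swap, .swap⟩

theorem complementSolvable_rotate_iff {v : ℤ × ℤ} {k : ℕ} :
    ComplementSolvable ((5, 5) - v) k ↔ ComplementSolvable v k :=
  ⟨fun h => sub_sub_cancel (5, 5) v ▸ h.rotate, .rotate⟩

theorem exists_solution_complementSolvable_iff {v : ℤ × ℤ} (hv : v ∈ Rhombus 6) :
    ∃ s ∈ solutions, ∀ k, ComplementSolvable v k ↔ ComplementSolvable (hole s.1) k := by
  obtain ⟨i, hi, rfl⟩ := exists_hole_of_mem_rhombus hv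
  obtain ⟨s, hs, h⟩ := exists_solution_symmetric i hi
  refine ⟨s, hs, fun k => ?_⟩
  obtain h | h | h | h := h <;>
    simp only [h, complementSolvable_swap_iff, complementSolvable_rotate_iff]

/-- On `Rhombus 6`, every complement problem has a solution of at most
14 moves and no solution of fewer than 13 moves. -/
theorem rhombus6_complement_13_to_14_moves :
    ∀ v ∈ Rhombus 6,
      (∃ ms : List ((ℤ × ℤ) × List (ℤ × ℤ)),
        Plays (Rhombus 6) ((Rhombus 6).erase v) ms {v} ∧ ms.length ≤ 14) ∧
      (∀ ms : List ((ℤ × ℤ) × List (ℤ × ℤ)),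
        Plays (Rhombus 6) ((Rhombus 6).erase v) ms {v} → 13 ≤ ms.length) := by
  intro v hv
  obtain ⟨s, hs, hiff⟩ := exists_solution_complementSolvable_iff hv
  constructor
  · obtain ⟨k, hk, hsol⟩ := exists_complementSolvable hs
    obtain ⟨ms, hms, rfl⟩ := (hiff k).2 hsol
    exact ⟨ms, hms, hk⟩
  · exact fun ms hms => thirteen_le_of_complementSolvable hs ((hiff _).1 ⟨ms, hms, rfl⟩)
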